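/- Solidarity over selection weights (Lemma 3.4, operator form): Let T_1, …, T_d and Π be bounded linear operators on H with ‖T_i − Π‖ ≤ 1 for every i. If there exist weights w_1,…,w_d with w_i > 0 and ∑_{i=1}^d w_i = 1 such that ‖∑_{i=1}^d w_i T_i − Π‖ < 1, then for every choice of weights w̃_1,…,w̃_d with w̃_i > 0 and ∑_{i=1}^d w̃_i = 1 it holds that ‖∑_{i=1}^d w̃_i T_i − Π‖ < 1. -/

import Mathlib

/-- If some convex combination with positive weights of vectors in the closed unit ball has norm
less than one, then so does every convex combination with positive weights. -/
theorem norm_sum_smul_lt_one_of_pos_weights {ι E : Type*} [Fintype ι] [SeminormedAddCommGroup E]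
    [NormedSpace ℝ E] {S : ι → E} (hS : ∀ i, ‖S i‖ ≤ 1) {w w' : ι → ℝ} (hw : ∀ i, 0 < w i)
    (hw_sum : ∑ i, w i = 1) (hlt : ‖∑ i, w i • S i‖ < 1) (hw' : ∀ i, 0 < w' i)
    (hw'_sum : ∑ i, w' i = 1) : ‖∑ i, w' i • S i‖ < 1 := by
  have hne : (Finset.univ : Finset ι).Nonempty :=
    Finset.nonempty_of_sum_ne_zero (hw_sum ▸ one_ne_zero)
  obtain ⟨j, -, hj⟩ := Finset.exists_min_image Finset.univ (fun i => w' i / w i) hne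
  set c := w' j / w j
  have hc : 0 < c := div_pos (hw' j) (hw j)
  have hcw : ∀ i, 0 ≤ w' i - c * w i := fun i =>
    sub_nonneg.2 ((le_div_iff₀ (hw i)).1 (hj i (Finset.mem_univ i)))
  have hsplit : ∑ i, w' i • S i = c • ∑ i, w i • S i + ∑ i, (w' i - c * w i) • S i := by
    simp [Finset.smul_sum, sub_smul, mul_smul]
  have hrem : ‖∑ i, (w' i - c * w i) • S i‖ ≤ 1 - c :=
    calc ‖∑ i, (w' i - c * w i) • S i‖ ≤ ∑ i, (w' i - c * w i) :=
          norm_sum_le_of_le _ fun i _ => by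
            rw [norm_smul, Real.norm_of_nonneg (hcw i)]
            exact mul_le_of_le_one_right (hcw i) (hS i)
      _ = 1 - c := by rw [Finset.sum_sub_distrib, ← Finset.mul_sum, hw_sum, hw'_sum, mul_one]
  calc ‖∑ i, w' i • S i‖ ≤ c * ‖∑ i, w i • S i‖ + ‖∑ i, (w' i - c * w i) • S i‖ := by
        rw [hsplit]
        refine (norm_add_le _ _).trans_eq ?_
        rw [norm_smul, Real.norm_of_nonneg hc.le]
    _ < c * 1 + (1 - c) := add_lt_add_of_lt_of_le (mul_lt_mul_of_pos_left hlt hc) hrem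
    _ = 1 := by ring

/-- Solidarity over selection weights (Lemma 3.4, operator form). -/
theorem weight_solidarity
    {H : Type*} [NormedAddCommGroup H] [InnerProductSpace ℝ H]
    {d : ℕ} (hd : 2 ≤ d) (T : Fin d → H →L[ℝ] H) (Q : H →L[ℝ] H)
    (hT : ∀ i, ‖T i - Q‖ ≤ 1)
    (h : ∃ w : Fin d → ℝ, (∀ i, 0 < w i) ∧ ∑ i, w i = 1 ∧
          ‖(∑ i, w i • T i) - Q‖ < 1) :
    ∀ w' : Fin d → ℝ, (∀ i, 0 < w' i) → ∑ i, w' i = 1 →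
      ‖(∑ i, w' i • T i) - Q‖ < 1 := by
  obtain ⟨w, hw, hw_sum, hlt⟩ := h
  intro w' hw' hw'_sum
  have sum_sub : ∀ v : Fin d → ℝ, ∑ i, v i = 1 →
      (∑ i, v i • T i) - Q = ∑ i, v i • (T i - Q) := fun v hv => by
    simp only [smul_sub, Finset.sum_sub_distrib, ← Finset.sum_smul, hv, one_smul]
  rw [sum_sub w hw_sum] at hlt
  rw [sum_sub w' hw'_sum]
  exact norm_sum_smul_lt_one_of_pos_weights hT hw hw_sum hlt hw' hw'_sum
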